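/- arXiv:1603.02658 — 3 statements merged into one kernel-verified Lean document; each statement's English description precedes it below -/
import Mathlib

section
/- Among even functions, η is the minimizer of the energy on the unit L² sphere: for every function ψ : ℝ → ℝ which is even (ψ(−x) = ψ(x)), differentiable with derivative ψ', such that ψ and ψ' are square-integrable and ∫_ℝ ψ² = 1, one has H(ψ) ≥ H(η); equality holds if and only if ψ = η or ψ = −η. -/
open MeasureTheory

/-- The ground state `η(x) = (1/2) sech(x/2)`. -/
noncomputable def eta (x : ℝ) : ℝ := (1/2) * (1 / Real.cosh (x/2))

/-- The energy `H(ψ) = (1/4) ∫ (ψ'² − ψ⁴)`. -/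
noncomputable def energy (ψ : ℝ → ℝ) : ℝ := (1/4) * ∫ x : ℝ, ((deriv ψ x)^2 - (ψ x)^4)

open Filter Topology

section SquareIntegrable

variable {ψ : ℝ → ℝ}

theorem integrable_mul_deriv_of_sq (hdiff : Differentiable ℝ ψ)
    (hL2 : Integrable (fun x => (ψ x)^2)) (hL2' : Integrable (fun x => (deriv ψ x)^2)) :
    Integrable (fun x => ψ x * deriv ψ x) :=
  ((memLp_two_iff_integrable_sq hdiff.continuous.aestronglyMeasurable).2 hL2).integrable_mul
    ((memLp_two_iff_integrable_sq (measurable_deriv ψ).aestronglyMeasurable).2 hL2')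

theorem hasDerivAt_sq (hdiff : Differentiable ℝ ψ) (x : ℝ) :
    HasDerivAt (fun x => (ψ x)^2) (2 * (ψ x * deriv ψ x)) x := by
  convert! (hdiff x).hasDerivAt.pow 2 using 1
  ring

theorem tendsto_sq_atTop (hdiff : Differentiable ℝ ψ)
    (hL2 : Integrable (fun x => (ψ x)^2)) (hL2' : Integrable (fun x => (deriv ψ x)^2)) :
    Tendsto (fun x => (ψ x)^2) atTop (𝓝 0) :=
  tendsto_zero_of_hasDerivAt_of_integrableOn_Ioi (a := 0) (fun x _ => hasDerivAt_sq hdiff x)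
    ((integrable_mul_deriv_of_sq hdiff hL2 hL2').const_mul 2).integrableOn hL2.integrableOn

theorem tendsto_sq_atBot (hdiff : Differentiable ℝ ψ)
    (hL2 : Integrable (fun x => (ψ x)^2)) (hL2' : Integrable (fun x => (deriv ψ x)^2)) :
    Tendsto (fun x => (ψ x)^2) atBot (𝓝 0) :=
  tendsto_zero_of_hasDerivAt_of_integrableOn_Iic (a := 0) (fun x _ => hasDerivAt_sq hdiff x)
    ((integrable_mul_deriv_of_sq hdiff hL2 hL2').const_mul 2).integrableOn hL2.integrableOn

theorem exists_sq_le (hdiff : Differentiable ℝ ψ)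
    (hL2 : Integrable (fun x => (ψ x)^2)) (hL2' : Integrable (fun x => (deriv ψ x)^2)) :
    ∃ C, ∀ x, (ψ x)^2 ≤ C := by
  have hint := (integrable_mul_deriv_of_sq hdiff hL2 hL2').const_mul 2
  refine ⟨(ψ 0)^2 + ∫ x, ‖2 * (ψ x * deriv ψ x)‖, fun x => ?_⟩
  have hftc := intervalIntegral.integral_eq_sub_of_hasDerivAt (a := 0) (b := x)
    (fun y _ => hasDerivAt_sq hdiff y) hint.intervalIntegrable
  have hle : ‖∫ y in (0 : ℝ)..x, 2 * (ψ y * deriv ψ y)‖ ≤ ∫ y, ‖2 * (ψ y * deriv ψ y)‖ :=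
    intervalIntegral.norm_integral_le_integral_norm_uIoc.trans
      (setIntegral_le_integral hint.norm (ae_of_all _ fun _ => norm_nonneg _))
  rw [hftc] at hle
  linarith [Real.le_norm_self ((ψ x)^2 - (ψ 0)^2)]

theorem integrable_pow_four (hdiff : Differentiable ℝ ψ)
    (hL2 : Integrable (fun x => (ψ x)^2)) (hL2' : Integrable (fun x => (deriv ψ x)^2)) :
    Integrable (fun x => (ψ x)^4) := by
  obtain ⟨C, hC⟩ := exists_sq_le hdiff hL2 hL2'
  convert! hL2.bdd_mul (c := C) (hdiff.continuous.pow 2).aestronglyMeasurable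
    (ae_of_all _ fun x => by simpa using hC x) using 1
  ext x
  simp only [Pi.pow_apply]
  ring

/-- Completing the square in the energy, where `F` is the primitive of `ψ²` with limits `±1/2`. -/
theorem integral_deriv_sq_sub_pow_four {F : ℝ → ℝ} (hdiff : Differentiable ℝ ψ)
    (hL2 : Integrable (fun x => (ψ x)^2)) (hL2' : Integrable (fun x => (deriv ψ x)^2))
    (hF : ∀ x, HasDerivAt F ((ψ x)^2) x) (hbot : Tendsto F atBot (𝓝 (-(1/2))))
    (htop : Tendsto F atTop (𝓝 (1/2))) :
    Integrable (fun x => (deriv ψ x + ψ x * F x)^2) ∧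
      ∫ x, ((deriv ψ x)^2 - (ψ x)^4) = (∫ x, (deriv ψ x + ψ x * F x)^2) - 1/12 := by
  have hmono : Monotone F := monotone_of_hasDerivAt_nonneg hF fun x => sq_nonneg (ψ x)
  have hFbound : ∀ x, ‖F x‖ ≤ 1/2 := fun x =>
    abs_le.2 ⟨hmono.le_of_tendsto hbot x, hmono.ge_of_tendsto htop x⟩
  have hFmeas : AEStronglyMeasurable F volume :=
    (continuous_iff_continuousAt.2 fun x => (hF x).continuousAt).aestronglyMeasurable
  have h4 := integrable_pow_four hdiff hL2 hL2'
  have hcross : Integrable (fun x => F x * (2 * (ψ x * deriv ψ x))) :=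
    ((integrable_mul_deriv_of_sq hdiff hL2 hL2').const_mul 2).bdd_mul hFmeas
      (ae_of_all _ hFbound)
  have hquad : Integrable (fun x => F x * (F x * (ψ x)^2)) :=
    (hL2.bdd_mul hFmeas (ae_of_all _ hFbound)).bdd_mul hFmeas (ae_of_all _ hFbound)
  have hprim : ∀ x, HasDerivAt (fun x => (ψ x)^2 * F x + (F x)^3 / 3)
      (F x * (2 * (ψ x * deriv ψ x)) + F x * (F x * (ψ x)^2) + (ψ x)^4) x := by
    intro x
    convert! ((hasDerivAt_sq hdiff x).mul (hF x)).add (((hF x).pow 3).div_const 3) using 1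
    push_cast
    ring
  have htotal := integral_of_hasDerivAt_of_tendsto hprim ((hcross.add hquad).add h4)
    (((tendsto_sq_atBot hdiff hL2 hL2').mul hbot).add ((hbot.pow 3).div_const 3))
    (((tendsto_sq_atTop hdiff hL2 hL2').mul htop).add ((htop.pow 3).div_const 3))
  have hexpand : (fun x => (deriv ψ x + ψ x * F x)^2) = fun x =>
      ((deriv ψ x)^2 - (ψ x)^4) +
        (F x * (2 * (ψ x * deriv ψ x)) + F x * (F x * (ψ x)^2) + (ψ x)^4) := by
    ext x
    ring
  rw [hexpand]
  refine ⟨(hL2'.sub h4).add ((hcross.add hquad).add h4), ?_⟩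
  have hadd := integral_add (hL2'.sub h4) ((hcross.add hquad).add h4)
  simp only [Pi.add_apply, Pi.sub_apply] at hadd
  rw [hadd, htotal]
  norm_num

end SquareIntegrable

/-- A differentiable function satisfying `f' = -g f` almost everywhere is the exponential one. -/
theorem eq_mul_exp_of_ae_deriv_eq {f g : ℝ → ℝ} (hf : Differentiable ℝ f) (hg : Continuous g)
    (h : ∀ᵐ x, deriv f x = -(g x * f x)) (x : ℝ) :
    f x = f 0 * Real.exp (-∫ t in (0 : ℝ)..x, g t) := by
  have hG : ∀ y, HasDerivAt (fun y => ∫ t in (0 : ℝ)..y, g t) (g y) y := fun y =>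
    hg.integral_hasStrictDerivAt 0 y |>.hasDerivAt
  have hprod : ∀ y, HasDerivAt (fun y => f y * Real.exp (∫ t in (0 : ℝ)..y, g t))
      ((deriv f y + g y * f y) * Real.exp (∫ t in (0 : ℝ)..y, g t)) y := by
    intro y
    convert! (hf y).hasDerivAt.mul (hG y).exp using 1
    ring
  have hzero : (fun y => (deriv f y + g y * f y) * Real.exp (∫ t in (0 : ℝ)..y, g t))
      =ᵐ[volume] fun _ => 0 := by
    filter_upwards [h] with y hy
    rw [hy]
    ring
  have hftc := intervalIntegral.integral_eq_sub_of_hasDerivAt (a := 0) (b := x)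
    (fun y _ => hprod y) ((integrable_zero ℝ ℝ volume).congr hzero.symm).intervalIntegrable
  rw [intervalIntegral.integral_congr_ae (g := fun _ => 0) (by
    filter_upwards [hzero] with y hy _ using hy)] at hftc
  simp only [intervalIntegral.integral_zero, intervalIntegral.integral_same, Real.exp_zero,
    mul_one] at hftc
  rw [Real.exp_neg, eq_mul_inv_iff_mul_eq₀ (Real.exp_ne_zero _)]
  linarith

/-- The odd primitive `tanh(x/2)/2` of `η²`, in logistic form. -/
noncomputable def etaPrimitive (x : ℝ) : ℝ := 1/2 - 1 / (Real.exp x + 1)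

theorem etaPrimitive_zero : etaPrimitive 0 = 0 := by
  norm_num [etaPrimitive]

theorem eta_eq_exp_div (x : ℝ) : eta x = Real.exp (x/2) / (Real.exp x + 1) := by
  have hx : Real.exp x = Real.exp (x/2) * Real.exp (x/2) := by
    rw [← Real.exp_add, add_halves]
  rw [eta, Real.cosh_eq, Real.exp_neg, hx]
  have := Real.exp_pos (x/2)
  field_simp

theorem eta_sq (x : ℝ) : (eta x)^2 = 1/4 - (etaPrimitive x)^2 := by
  have hx : Real.exp x = Real.exp (x/2) * Real.exp (x/2) := by
    rw [← Real.exp_add, add_halves]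
  have := Real.exp_pos (x/2)
  rw [eta_eq_exp_div, etaPrimitive, hx]
  field_simp
  ring

theorem hasDerivAt_etaPrimitive (x : ℝ) : HasDerivAt etaPrimitive ((eta x)^2) x := by
  have hpos : Real.exp x + 1 ≠ 0 := by positivity
  convert! (((Real.hasDerivAt_exp x).add_const 1).inv hpos).const_sub (1/2) using 1
  · ext y
    simp [etaPrimitive]
  · rw [eta_sq, etaPrimitive]
    field_simp
    ring

theorem hasDerivAt_eta (x : ℝ) : HasDerivAt eta (-(etaPrimitive x * eta x)) x := by
  have hpos : Real.exp x + 1 ≠ 0 := by positivity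
  convert! (((hasDerivAt_id x).div_const 2).exp).div ((Real.hasDerivAt_exp x).add_const 1)
    hpos using 1
  · ext y
    simp [eta_eq_exp_div]
  · rw [eta_eq_exp_div, etaPrimitive]
    simp only [id]
    field_simp
    ring

theorem differentiable_eta : Differentiable ℝ eta := fun x => (hasDerivAt_eta x).differentiableAt

theorem tendsto_etaPrimitive_atTop : Tendsto etaPrimitive atTop (𝓝 (1/2)) := by
  have h : Tendsto (fun x => 1 / (Real.exp x + 1)) atTop (𝓝 0) :=
    tendsto_const_nhds.div_atTop (tendsto_atTop_add_const_right _ _ Real.tendsto_exp_atTop)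
  simpa only [sub_zero] using! h.const_sub (1/2)

theorem tendsto_etaPrimitive_atBot : Tendsto etaPrimitive atBot (𝓝 (-(1/2))) := by
  have h := ((tendsto_const_nhds (x := (1 : ℝ))).div (Real.tendsto_exp_atBot.add_const 1)
    (by norm_num)).const_sub (1/2)
  convert! h using 2
  norm_num

theorem integrable_eta_sq : Integrable (fun x => (eta x)^2) := by
  have hcont : Continuous (fun x => (eta x)^2) := differentiable_eta.continuous.pow 2
  refine integrable_of_intervalIntegral_norm_tendsto (1/2 - -(1/2)) (a := fun x : ℝ => -x)
    (b := id) (fun x => hcont.integrableOn_Ioc) tendsto_neg_atTop_atBot tendsto_id ?_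
  have hftc : ∀ x : ℝ, ∫ t in -x..id x, ‖(eta t)^2‖ = etaPrimitive x - etaPrimitive (-x) := by
    intro x
    simp only [Real.norm_of_nonneg (sq_nonneg _)]
    exact intervalIntegral.integral_eq_sub_of_hasDerivAt (fun y _ => hasDerivAt_etaPrimitive y)
      (hcont.intervalIntegrable _ _)
  simp only [hftc]
  exact tendsto_etaPrimitive_atTop.sub
    (tendsto_etaPrimitive_atBot.comp tendsto_neg_atTop_atBot)

theorem integrable_deriv_eta_sq : Integrable (fun x => (deriv eta x)^2) := by
  refine integrable_eta_sq.mono' ((measurable_deriv eta).pow_const 2).aestronglyMeasurable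
    (ae_of_all _ fun x => ?_)
  rw [(hasDerivAt_eta x).deriv, Real.norm_of_nonneg (sq_nonneg _)]
  have h : (etaPrimitive x)^2 ≤ 1 := by nlinarith [eta_sq x, sq_nonneg (eta x)]
  nlinarith [sq_nonneg (eta x)]

theorem energy_eta : energy eta = -(1/48) := by
  rw [energy, (integral_deriv_sq_sub_pow_four differentiable_eta integrable_eta_sq
    integrable_deriv_eta_sq hasDerivAt_etaPrimitive tendsto_etaPrimitive_atBot
    tendsto_etaPrimitive_atTop).2]
  have h : ∀ x, deriv eta x + eta x * etaPrimitive x = 0 := fun x => by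
    rw [(hasDerivAt_eta x).deriv]
    ring
  simp only [h]
  norm_num

theorem energy_neg (ψ : ℝ → ℝ) : energy (fun x => -ψ x) = energy ψ := by
  simp [energy, Even.neg_pow (n := 4) (by decide)]

/-- An odd primitive of the square of an even normalized function has limits `±1/2`. -/
theorem exists_primitive_sq_of_even {ψ : ℝ → ℝ} (heven : ∀ x, ψ (-x) = ψ x)
    (hcont : Continuous ψ) (hL2 : Integrable (fun x => (ψ x)^2))
    (hnorm : (∫ x : ℝ, (ψ x)^2) = 1) :
    ∃ F : ℝ → ℝ, F 0 = 0 ∧ (∀ x, HasDerivAt F ((ψ x)^2) x) ∧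
      Tendsto F atBot (𝓝 (-(1/2))) ∧ Tendsto F atTop (𝓝 (1/2)) := by
  have hsymm : ∫ x in Set.Ioi (0 : ℝ), (ψ x)^2 = ∫ x in Set.Iic (0 : ℝ), (ψ x)^2 := by
    simpa [heven] using integral_comp_neg_Ioi (0 : ℝ) (fun x => (ψ x)^2)
  have hsum := intervalIntegral.integral_Iic_add_Ioi (b := (0 : ℝ)) hL2.integrableOn
    hL2.integrableOn
  refine ⟨fun x => ∫ t in (0 : ℝ)..x, (ψ t)^2, by simp, fun x =>
    ((hcont.pow 2).integral_hasStrictDerivAt 0 x).hasDerivAt, ?_, ?_⟩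
  · have h := (intervalIntegral_tendsto_integral_Iic (0 : ℝ) hL2.integrableOn tendsto_id).neg
    rw [show ∫ x in Set.Iic (0 : ℝ), (ψ x)^2 = 1/2 by linarith] at h
    simpa only [id, ← intervalIntegral.integral_symm] using h
  · have h := intervalIntegral_tendsto_integral_Ioi (0 : ℝ) hL2.integrableOn tendsto_id
    rwa [show ∫ x in Set.Ioi (0 : ℝ), (ψ x)^2 = 1/2 by linarith] at h

/-- The first-order equation `ψ' = -ψ F` with `F' = ψ²`, `F 0 = 0` characterizes `±η`. -/
theorem eq_eta_or_eq_neg_eta {ψ F : ℝ → ℝ} (hdiff : Differentiable ℝ ψ)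
    (hψ : Tendsto (fun x => (ψ x)^2) atTop (𝓝 0)) (hF0 : F 0 = 0)
    (hF : ∀ x, HasDerivAt F ((ψ x)^2) x) (htop : Tendsto F atTop (𝓝 (1/2)))
    (h : ∀ᵐ x, deriv ψ x = -(F x * ψ x)) :
    ψ = eta ∨ ψ = fun x => -eta x := by
  have hFcont : Continuous F := continuous_iff_continuousAt.2 fun x => (hF x).continuousAt
  have hGcont : Continuous etaPrimitive :=
    continuous_iff_continuousAt.2 fun x => (hasDerivAt_etaPrimitive x).continuousAt
  have hψexp := eq_mul_exp_of_ae_deriv_eq hdiff hFcont h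
  have hψ' : ∀ x, HasDerivAt ψ (-(F x * ψ x)) x := by
    intro x
    have hint : HasDerivAt (fun y => ∫ t in (0 : ℝ)..y, F t) (F x) x :=
      (hFcont.integral_hasStrictDerivAt 0 x).hasDerivAt
    convert! (hint.neg.exp.const_mul (ψ 0)) using 1
    · exact funext hψexp
    · rw [hψexp x]
      simp only [Pi.neg_apply]
      ring
  have hcons' : ∀ x, HasDerivAt (fun x => (ψ x)^2 + (F x)^2) 0 x := by
    intro x
    convert! ((hψ' x).pow 2).add ((hF x).pow 2) using 1
    push_cast
    ring
  have hlim : Tendsto (fun x => (ψ x)^2 + (F x)^2) atTop (𝓝 (1/4)) := by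
    convert! hψ.add (htop.pow 2) using 2
    norm_num
  have hcons : ∀ x, (ψ x)^2 = 1/4 - (F x)^2 := by
    intro x
    have hconst : (fun x => (ψ x)^2 + (F x)^2) = fun _ => (ψ x)^2 + (F x)^2 :=
      funext fun y => is_const_of_deriv_eq_zero (fun z => (hcons' z).differentiableAt)
        (fun z => (hcons' z).deriv) y x
    rw [hconst] at hlim
    linarith [tendsto_nhds_unique hlim tendsto_const_nhds]
  have hw : ∀ x, HasDerivAt (fun x => F x - etaPrimitive x)
      (-((F x + etaPrimitive x) * (F x - etaPrimitive x))) x := by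
    intro x
    convert! (hF x).sub (hasDerivAt_etaPrimitive x) using 1
    rw [hcons, eta_sq]
    ring
  have hFG : F = etaPrimitive := by
    ext x
    have := eq_mul_exp_of_ae_deriv_eq (fun x => (hw x).differentiableAt) (hFcont.add hGcont)
      (ae_of_all _ fun x => (hw x).deriv) x
    simpa [hF0, etaPrimitive_zero, sub_eq_zero] using this
  have hetaexp := eq_mul_exp_of_ae_deriv_eq differentiable_eta hGcont
    (ae_of_all _ fun x => (hasDerivAt_eta x).deriv)
  have h0 : (ψ 0)^2 = (eta 0)^2 := by rw [hcons, eta_sq, hFG]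
  rcases sq_eq_sq_iff_eq_or_eq_neg.1 h0 with h0 | h0
  · left
    ext x
    rw [hψexp, hetaexp, h0, hFG]
  · right
    ext x
    rw [hψexp, hetaexp, h0, hFG, neg_mul]

/-- among even `H¹` functions on the unit `L²` sphere, `η` minimizes the energy,
with equality exactly for `ψ = η` or `ψ = −η`. -/
theorem eta_minimizes_energy (ψ : ℝ → ℝ)
    (heven : ∀ x, ψ (-x) = ψ x)
    (hdiff : Differentiable ℝ ψ)
    (hL2 : Integrable (fun x => (ψ x)^2))
    (hL2' : Integrable (fun x => (deriv ψ x)^2))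
    (hnorm : (∫ x : ℝ, (ψ x)^2) = 1) :
    energy ψ ≥ energy eta ∧
    (energy ψ = energy eta ↔ ψ = eta ∨ ψ = fun x => -eta x) := by
  obtain ⟨F, hF0, hF, hbot, htop⟩ := exists_primitive_sq_of_even heven hdiff.continuous hL2 hnorm
  obtain ⟨hint, hsq⟩ := integral_deriv_sq_sub_pow_four hdiff hL2 hL2' hF hbot htop
  have henergy : energy ψ = energy eta + (1/4) * ∫ x, (deriv ψ x + ψ x * F x)^2 := by
    rw [energy_eta, energy, hsq]
    ring
  have hnonneg : 0 ≤ ∫ x, (deriv ψ x + ψ x * F x)^2 := integral_nonneg fun x => sq_nonneg _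
  refine ⟨by linarith, fun heq => ?_, ?_⟩
  · have hzero : ∫ x, (deriv ψ x + ψ x * F x)^2 = 0 := by linarith
    rw [integral_eq_zero_iff_of_nonneg (fun x => sq_nonneg _) hint] at hzero
    refine eq_eta_or_eq_neg_eta hdiff (tendsto_sq_atTop hdiff hL2 hL2') hF0 hF htop ?_
    filter_upwards [hzero] with x hx
    have := pow_eq_zero_iff (two_ne_zero) |>.1 hx
    linarith
  · rintro (rfl | rfl)
    · rfl
    · exact energy_neg eta
end

section
/- Two-sided coercivity of the linearized operator (estimate (2.12)): there exist constants 0 < c ≤ C such that for every even function v : ℝ → ℝ that is differentiable with v and v' square-integrable and satisfies ⟨v, η⟩ = 0, one has c·‖v‖_{H¹}² ≤ ∫_ℝ ( (1/2)·v'(x)² + (1/8)·v(x)² − 3·η(x)²·v(x)² ) dx ≤ C·‖v‖_{H¹}², where ‖v‖_{H¹}² = ∫_ℝ (v² + v'²). -/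
open MeasureTheory

/-- Squared `H¹` norm: `‖f‖_{H¹}² = ∫ (f² + f'²)`. -/
noncomputable def H1sq (f : ℝ → ℝ) : ℝ := ∫ x : ℝ, ((f x)^2 + (deriv f x)^2)

open Filter Topology Set

/-- The kink `tanh (x / 2)`. -/
noncomputable def kink (x : ℝ) : ℝ := Real.tanh (x / 2)

/-- The squared profile `sech² (x / 2) = 1 - tanh² (x / 2)`. -/
noncomputable def sechSq (x : ℝ) : ℝ := 1 - kink x ^ 2

lemma kink_zero : kink 0 = 0 := by simp [kink]

lemma kink_eq (x : ℝ) : kink x = 1 - 2 / (Real.exp x + 1) := by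
  have h : Real.exp x = Real.exp (x / 2) * Real.exp (x / 2) := by
    rw [← Real.exp_add]; congr 1; ring
  have h0 := Real.exp_pos (x / 2)
  rw [kink, Real.tanh_eq_sinh_div_cosh, Real.sinh_eq, Real.cosh_eq, h, Real.exp_neg]
  field_simp
  ring

lemma tendsto_kink : Tendsto kink atTop (𝓝 1) := by
  have h : Tendsto (fun x => 1 - 2 / (Real.exp x + 1)) atTop (𝓝 (1 - 0)) :=
    tendsto_const_nhds.sub
      (tendsto_const_nhds.div_atTop (tendsto_atTop_add_const_right _ _ Real.tendsto_exp_atTop))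
  rw [sub_zero] at h
  exact h.congr fun x => (kink_eq x).symm

lemma hasDerivAt_kink (x : ℝ) : HasDerivAt kink (sechSq x / 2) x := by
  have h0 : Real.exp x + 1 ≠ 0 := by positivity
  have h : HasDerivAt (fun x => 1 - 2 / (Real.exp x + 1))
      (-((0 * (Real.exp x + 1) - 2 * Real.exp x) / (Real.exp x + 1) ^ 2)) x :=
    ((hasDerivAt_const x (2 : ℝ)).div ((Real.hasDerivAt_exp x).add_const 1) h0).const_sub 1
  rw [← funext kink_eq] at h
  convert h using 1
  rw [sechSq, kink_eq]
  field_simp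
  ring

lemma kink_pos {x : ℝ} (hx : 0 < x) : 0 < kink x := by
  rw [kink_eq, sub_pos, div_lt_one (by positivity)]
  have := Real.one_lt_exp_iff.2 hx
  linarith

lemma sechSq_eq_eta (x : ℝ) : sechSq x = 4 * eta x ^ 2 := by
  have h := Real.cosh_sq (x / 2)
  have h0 := Real.cosh_pos (x / 2)
  rw [sechSq, kink, eta, Real.tanh_eq_sinh_div_cosh]
  field_simp
  linarith

lemma eta_pos (x : ℝ) : 0 < eta x := by
  have h0 := Real.cosh_pos (x / 2)
  rw [eta]; positivity

lemma sechSq_pos (x : ℝ) : 0 < sechSq x := by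
  have := eta_pos x
  rw [sechSq_eq_eta]; positivity

lemma sechSq_le_one (x : ℝ) : sechSq x ≤ 1 := by
  rw [sechSq]; linarith [sq_nonneg (kink x)]

lemma hasDerivAt_sechSq (x : ℝ) : HasDerivAt sechSq (-(kink x * sechSq x)) x := by
  have h := ((hasDerivAt_kink x).fun_pow 2).const_sub 1
  convert! h using 1
  ring

lemma continuous_kink : Continuous kink :=
  continuous_iff_continuousAt.2 fun x => (hasDerivAt_kink x).continuousAt

lemma continuous_sechSq : Continuous sechSq :=
  continuous_iff_continuousAt.2 fun x => (hasDerivAt_sechSq x).continuousAt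

lemma continuous_eta : Continuous eta := by
  unfold eta
  have : ∀ x : ℝ, Real.cosh (x / 2) ≠ 0 := fun x => (Real.cosh_pos _).ne'
  fun_prop (disch := assumption)

lemma tendsto_sechSq : Tendsto sechSq atTop (𝓝 0) := by
  have h := (tendsto_kink.pow 2).const_sub 1
  rw [one_pow, sub_self] at h
  exact h

/-- The substitution `t = kink x` on the half-line. -/
lemma integral_Ioi_comp_kink {P p : ℝ → ℝ} (hP : ∀ t, HasDerivAt P (p t) t)
    (hp : ∀ x, 0 ≤ p (kink x)) (hP0 : P 0 = 0) :
    IntegrableOn (fun x => p (kink x) * (sechSq x / 2)) (Ioi 0) ∧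
      ∫ x in Ioi 0, p (kink x) * (sechSq x / 2) = P 1 := by
  have hd : ∀ x ∈ Ici (0 : ℝ), HasDerivAt (P ∘ kink) (p (kink x) * (sechSq x / 2)) x :=
    fun x _ => (hP _).comp x (hasDerivAt_kink x)
  have hn : ∀ x ∈ Ioi (0 : ℝ), 0 ≤ p (kink x) * (sechSq x / 2) := fun x _ =>
    mul_nonneg (hp x) (by linarith [sechSq_pos x])
  have hl : Tendsto (P ∘ kink) atTop (𝓝 (P 1)) := (hP 1).continuousAt.tendsto.comp tendsto_kink
  refine ⟨integrableOn_Ioi_deriv_of_nonneg' hd hn hl, ?_⟩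
  rw [integral_Ioi_of_hasDerivAt_of_nonneg' hd hn hl]
  simp [kink_zero, hP0]

lemma integral_sechSq :
    IntegrableOn sechSq (Ioi 0) ∧ ∫ x in Ioi 0, sechSq x = 2 := by
  have h := integral_Ioi_comp_kink (P := fun t => 2 * t) (p := fun _ => 2)
    (fun t => by simpa using (hasDerivAt_id t).const_mul 2) (fun _ => by norm_num) (by norm_num)
  have e : (fun x => 2 * (sechSq x / 2)) = sechSq := by funext x; ring
  simpa only [e, mul_one] using h

lemma integral_sechSq_sq :
    IntegrableOn (fun x => sechSq x ^ 2) (Ioi 0) ∧ ∫ x in Ioi 0, sechSq x ^ 2 = 4 / 3 := by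
  have h := integral_Ioi_comp_kink (P := fun t => 2 * t - 2 / 3 * t ^ 3)
    (p := fun t => 2 * (1 - t ^ 2))
    (fun t => by
      convert! ((hasDerivAt_id t).const_mul 2).sub ((hasDerivAt_pow 3 t).const_mul (2 / 3)) using 1
      norm_num
      ring)
    (fun x => by have := sechSq_pos x; rw [sechSq] at this; linarith) (by norm_num)
  have e : (fun x => 2 * (1 - kink x ^ 2) * (sechSq x / 2)) = fun x => sechSq x ^ 2 := by
    funext x; rw [sechSq]; ring
  simp only [e] at h
  exact ⟨h.1, h.2.trans (by norm_num)⟩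

lemma integral_sechSq_cube :
    IntegrableOn (fun x => sechSq x ^ 3) (Ioi 0) ∧ ∫ x in Ioi 0, sechSq x ^ 3 = 16 / 15 := by
  have h := integral_Ioi_comp_kink (P := fun t => 2 * t - 4 / 3 * t ^ 3 + 2 / 5 * t ^ 5)
    (p := fun t => 2 * (1 - t ^ 2) ^ 2)
    (fun t => by
      convert! (((hasDerivAt_id t).const_mul 2).sub
        ((hasDerivAt_pow 3 t).const_mul (4 / 3))).add
        ((hasDerivAt_pow 5 t).const_mul (2 / 5)) using 1
      norm_num
      ring)
    (fun x => by positivity) (by norm_num)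
  have e : (fun x => 2 * (1 - kink x ^ 2) ^ 2 * (sechSq x / 2)) = fun x => sechSq x ^ 3 := by
    funext x; rw [sechSq]; ring
  simp only [e] at h
  exact ⟨h.1, h.2.trans (by norm_num)⟩

lemma integrable_mul_of_integrable_sq {μ : Measure ℝ} {f g : ℝ → ℝ} (hf : Measurable f)
    (hg : Measurable g) (hf2 : Integrable (fun x => f x ^ 2) μ)
    (hg2 : Integrable (fun x => g x ^ 2) μ) : Integrable (fun x => f x * g x) μ :=
  ((memLp_two_iff_integrable_sq hf.aestronglyMeasurable).2 hf2).integrable_mul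
    ((memLp_two_iff_integrable_sq hg.aestronglyMeasurable).2 hg2)

lemma integrable_mul_of_abs_le_one {μ : Measure ℝ} {f g : ℝ → ℝ} (hg : Continuous g)
    (hb : ∀ x, |g x| ≤ 1) (hf : Integrable f μ) : Integrable (fun x => g x * f x) μ := by
  refine hf.mono (hg.aestronglyMeasurable.mul hf.aestronglyMeasurable)
    (Eventually.of_forall fun x => ?_)
  rw [norm_mul]
  exact mul_le_of_le_one_left (norm_nonneg _) (hb x)

lemma abs_sechSq_le_one (x : ℝ) : |sechSq x| ≤ 1 := by
  rw [abs_of_pos (sechSq_pos x)]; exact sechSq_le_one x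

lemma abs_kink_le_one (x : ℝ) : |kink x| ≤ 1 := by
  have := sechSq_pos x
  rw [sechSq] at this
  exact (sq_le_one_iff_abs_le_one _).1 (by linarith)

/-- An `H¹` function on the half-line vanishes at infinity. -/
lemma tendsto_zero_of_integrableOn_sq {r : ℝ → ℝ} (hr : Differentiable ℝ r)
    (h0 : IntegrableOn (fun x => r x ^ 2) (Ioi 0))
    (h1 : IntegrableOn (fun x => deriv r x ^ 2) (Ioi 0)) : Tendsto r atTop (𝓝 0) := by
  have hm := integrable_mul_of_integrable_sq hr.continuous.measurable (measurable_deriv r) h0 h1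
  have hd : ∀ x ∈ Ioi (0 : ℝ), HasDerivAt (fun x => r x ^ 2) (2 * (r x * deriv r x)) x := by
    intro x _
    convert! (hr x).hasDerivAt.fun_pow 2 using 1
    ring
  have h := tendsto_zero_of_hasDerivAt_of_integrableOn_Ioi hd (hm.const_mul 2) h0
  have h' := h.sqrt
  simp only [Real.sqrt_sq_eq_abs, Real.sqrt_zero] at h'
  exact (tendsto_zero_iff_abs_tendsto_zero r).2 h'

/-- If `u 0 = 0` then `u² / kink` extends continuously by `0` at the origin. -/
lemma continuousAt_sq_div_kink {u : ℝ → ℝ} {u' : ℝ} (hu : HasDerivAt u u' 0) (h0 : u 0 = 0) :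
    ContinuousAt (fun x => u x ^ 2 / kink x) 0 := by
  have hs := hasDerivAt_iff_tendsto_slope.1 hu
  have hk := hasDerivAt_iff_tendsto_slope.1 (hasDerivAt_kink 0)
  have hu0 : Tendsto u (𝓝[≠] 0) (𝓝 0) := by
    have := hu.continuousAt.tendsto.mono_left (nhdsWithin_le_nhds (s := {0}ᶜ))
    rwa [h0] at this
  have hne : sechSq 0 / 2 ≠ 0 := by have := sechSq_pos 0; positivity
  have h := hu0.mul (hs.div hk hne)
  rw [zero_mul] at h
  rw [continuousAt_iff_punctured_nhds, h0]
  simp only [ne_eq, OfNat.ofNat_ne_zero, not_false_eq_true, zero_pow, zero_div]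
  refine h.congr' ?_
  filter_upwards [self_mem_nhdsWithin] with x hx
  have hx : x ≠ 0 := hx
  simp only [slope_def_field, h0, kink_zero, sub_zero, Pi.div_apply]
  rw [div_div_div_cancel_right₀ hx]
  ring

/-- On functions orthogonal to `sechSq` on the half-line, `-∂² - (3/2) sechSq` is nonnegative. -/
lemma integral_nonneg_of_orthogonal_sechSq {r : ℝ → ℝ} (hr : Differentiable ℝ r)
    (h0 : IntegrableOn (fun x => r x ^ 2) (Ioi 0))
    (h1 : IntegrableOn (fun x => deriv r x ^ 2) (Ioi 0))
    (horth : ∫ x in Ioi 0, r x * sechSq x = 0) :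
    0 ≤ ∫ x in Ioi 0, (deriv r x ^ 2 - 3 / 2 * (sechSq x * r x ^ 2)) := by
  have hrp : IntegrableOn (fun x => r x * sechSq x) (Ioi 0) :=
    integrable_mul_of_integrable_sq hr.continuous.measurable continuous_sechSq.measurable h0
      integral_sechSq_sq.1
  have hφ : IntegrableOn (fun x => deriv r x ^ 2 - 3 / 2 * (sechSq x * r x ^ 2)) (Ioi 0) :=
    h1.sub ((integrable_mul_of_abs_le_one continuous_sechSq abs_sechSq_le_one h0).const_mul _)
  have hr0 := tendsto_zero_of_integrableOn_sq hr h0 h1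
  set F : ℝ → ℝ := fun x => ∫ y in (0 : ℝ)..x, r y * sechSq y with hF
  have hFd : ∀ x, HasDerivAt F (r x * sechSq x) x := fun x =>
    ((hr.continuous.mul continuous_sechSq).integral_hasStrictDerivAt 0 x).hasDerivAt
  have hF0 : F 0 = 0 := by simp [hF]
  have hFlim : Tendsto F atTop (𝓝 0) := by
    have := intervalIntegral_tendsto_integral_Ioi 0 hrp tendsto_id
    rwa [horth] at this
  set u : ℝ → ℝ := fun x => F x / sechSq x with hu
  have hud : ∀ x, HasDerivAt u (r x + kink x * u x) x := by
    intro x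
    have hp := (sechSq_pos x).ne'
    convert! (hFd x).div (hasDerivAt_sechSq x) hp using 1
    simp only [hu]
    field_simp
    ring
  have hu0 : u 0 = 0 := by simp [hu, hF0]
  have hulim : Tendsto u atTop (𝓝 0) := by
    refine HasDerivAt.lhopital_zero_atTop (Eventually.of_forall hFd)
      (Eventually.of_forall hasDerivAt_sechSq) ?_ hFlim tendsto_sechSq ?_
    · filter_upwards [eventually_gt_atTop 0] with x hx
      exact neg_ne_zero.2 (mul_pos (kink_pos hx) (sechSq_pos x)).ne'
    · have h := (hr0.div tendsto_kink one_ne_zero).neg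
      rw [zero_div, neg_zero] at h
      refine h.congr fun x => ?_
      rw [Pi.div_apply, div_neg, mul_div_mul_right _ _ (sechSq_pos x).ne']
  set G : ℝ → ℝ := fun x =>
    -(kink x * r x ^ 2 + 2 * (r x * u x) + (3 * (kink x * u x ^ 2) - u x ^ 2 / kink x) / 2) with hG
  have hGlim : Tendsto G atTop (𝓝 0) := by
    have h := (((tendsto_kink.mul (hr0.pow 2)).add ((hr0.mul hulim).const_mul 2)).add
      ((((tendsto_kink.mul (hulim.pow 2)).const_mul 3).sub
        ((hulim.pow 2).div tendsto_kink one_ne_zero)).div_const 2)).neg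
    convert! h using 2
    norm_num
  have hG0 : G 0 = 0 := by simp [hG, kink_zero, hu0]
  have hucont : Continuous u := continuous_iff_continuousAt.2 fun x => (hud x).continuousAt
  have hGcont : ∀ x ∈ Ici (0 : ℝ), ContinuousAt G x := by
    intro x hx
    have hq : ContinuousAt (fun x => u x ^ 2 / kink x) x := by
      rcases (mem_Ici.1 hx).eq_or_lt with rfl | hx
      · exact continuousAt_sq_div_kink (hud 0) hu0
      · exact (hucont.pow 2).continuousAt.div continuous_kink.continuousAt (kink_pos hx).ne'
    have hk := continuous_kink.continuousAt (x := x)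
    have hrc := hr.continuous.continuousAt (x := x)
    have huc := hucont.continuousAt (x := x)
    exact (((hk.mul (hrc.pow 2)).add ((hrc.mul huc).const_mul 2)).add
      ((((hk.mul (huc.pow 2)).const_mul 3).sub hq).div_const 2)).neg
  have hbound : ∀ X, 0 ≤ X →
      G X ≤ ∫ x in (0 : ℝ)..X, (deriv r x ^ 2 - 3 / 2 * (sechSq x * r x ^ 2)) := by
    intro X hX
    have hGd : ∀ x ∈ Ioo 0 X, HasDerivAt G
        (deriv r x ^ 2 - 3 / 2 * (sechSq x * r x ^ 2) - (deriv r x + kink x * r x + u x) ^ 2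
          - (r x + kink x * u x - sechSq x / (2 * kink x) * u x) ^ 2) x := by
      intro x hx
      have hk := hasDerivAt_kink x
      have hkne := (kink_pos hx.1).ne'
      have hrd := (hr x).hasDerivAt
      have huu := hud x
      convert! (((hk.mul (hrd.fun_pow 2)).add ((hrd.mul huu).const_mul 2)).add
        ((((hk.mul (huu.fun_pow 2)).const_mul 3).sub
          ((huu.fun_pow 2).div hk hkne)).div_const 2)).neg using 1
      simp only [Nat.cast_ofNat, Nat.add_one_sub_one, pow_one, sechSq]
      field_simp
      ring
    have h := intervalIntegral.sub_le_integral_of_hasDeriv_right_of_le hX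
      (fun x hx => (hGcont x hx.1).continuousWithinAt)
      (fun x hx => (hGd x hx).hasDerivWithinAt)
      ((integrableOn_Icc_iff_integrableOn_Ioc).2 (hφ.mono_set Ioc_subset_Ioi_self))
      (fun x _ => by
        linarith [sq_nonneg (deriv r x + kink x * r x + u x),
          sq_nonneg (r x + kink x * u x - sechSq x / (2 * kink x) * u x)])
    rwa [hG0, sub_zero] at h
  refine le_of_tendsto_of_tendsto hGlim (intervalIntegral_tendsto_integral_Ioi 0 hφ tendsto_id) ?_
  filter_upwards [eventually_ge_atTop 0] with X hX using hbound X hX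

/-- The quadratic form of `-∂² - (3/2) sechSq` is bounded below by its single negative mode. -/
lemma neg_inner_sechSq_sq_le {v : ℝ → ℝ} (hv : Differentiable ℝ v)
    (h0 : IntegrableOn (fun x => v x ^ 2) (Ioi 0))
    (h1 : IntegrableOn (fun x => deriv v x ^ 2) (Ioi 0)) :
    -(3 / 4 * (∫ x in Ioi 0, v x * sechSq x) ^ 2) ≤
      ∫ x in Ioi 0, (deriv v x ^ 2 - 3 / 2 * (sechSq x * v x ^ 2)) := by
  set W := ∫ x in Ioi 0, v x * sechSq x with hW
  set a : ℝ := 3 / 4 * W with ha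
  obtain ⟨i2, e2⟩ := integral_sechSq_sq
  obtain ⟨i3, e3⟩ := integral_sechSq_cube
  have ivp : IntegrableOn (fun x => v x * sechSq x) (Ioi 0) :=
    integrable_mul_of_integrable_sq hv.continuous.measurable continuous_sechSq.measurable h0 i2
  have idp : IntegrableOn (fun x => deriv v x * sechSq x) (Ioi 0) :=
    integrable_mul_of_integrable_sq (measurable_deriv v) continuous_sechSq.measurable h1 i2
  have iφ : IntegrableOn (fun x => deriv v x ^ 2 - 3 / 2 * (sechSq x * v x ^ 2)) (Ioi 0) :=
    h1.sub ((integrable_mul_of_abs_le_one continuous_sechSq abs_sechSq_le_one h0).const_mul _)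
  have hrd : ∀ x, HasDerivAt (fun x => v x - a * sechSq x)
      (deriv v x + a * (kink x * sechSq x)) x := by
    intro x
    convert! (hv x).hasDerivAt.sub ((hasDerivAt_sechSq x).const_mul a) using 1
    ring
  have hr : Differentiable ℝ fun x => v x - a * sechSq x := fun x => (hrd x).differentiableAt
  have hderiv : deriv (fun x => v x - a * sechSq x) =
      fun x => deriv v x + a * (kink x * sechSq x) := funext fun x => (hrd x).deriv
  have ik : IntegrableOn (fun x => kink x * (kink x * sechSq x ^ 2)) (Ioi 0) :=
    integrable_mul_of_abs_le_one continuous_kink abs_kink_le_one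
      (integrable_mul_of_abs_le_one continuous_kink abs_kink_le_one i2)
  have ikd : IntegrableOn (fun x => kink x * (deriv v x * sechSq x)) (Ioi 0) :=
    integrable_mul_of_abs_le_one continuous_kink abs_kink_le_one idp
  have hr0 : IntegrableOn (fun x => (v x - a * sechSq x) ^ 2) (Ioi 0) := by
    convert! (h0.sub (ivp.const_mul (2 * a))).add (i2.const_mul (a ^ 2)) using 1
    funext x
    simp only [Pi.add_apply, Pi.sub_apply]
    ring
  have hr1 : IntegrableOn (fun x => deriv (fun x => v x - a * sechSq x) x ^ 2) (Ioi 0) := by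
    rw [hderiv]
    convert! (h1.add (ikd.const_mul (2 * a))).add (ik.const_mul (a ^ 2)) using 1
    funext x
    simp only [Pi.add_apply]
    ring
  have horth : ∫ x in Ioi 0, (v x - a * sechSq x) * sechSq x = 0 := by
    have : (fun x => (v x - a * sechSq x) * sechSq x) =
        fun x => v x * sechSq x - a * sechSq x ^ 2 := by funext x; ring
    rw [this, integral_sub ivp (i2.const_mul a), integral_const_mul, e2, ← hW, ha]
    ring
  have key := integral_nonneg_of_orthogonal_sechSq hr hr0 hr1 horth
  set H : ℝ → ℝ := fun x => 2 * (kink x * (sechSq x * v x)) with hH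
  set H' : ℝ → ℝ := fun x =>
    sechSq x * (v x * sechSq x) - 2 * (kink x * (kink x * (v x * sechSq x)))
      + 2 * (kink x * (deriv v x * sechSq x)) with hH'
  have iH' : IntegrableOn H' (Ioi 0) :=
    ((integrable_mul_of_abs_le_one continuous_sechSq abs_sechSq_le_one ivp).sub
      ((integrable_mul_of_abs_le_one continuous_kink abs_kink_le_one
        (integrable_mul_of_abs_le_one continuous_kink abs_kink_le_one ivp)).const_mul 2)).add
      (ikd.const_mul 2)
  have eH : ∫ x in Ioi 0, H' x = 0 := by
    have hd : ∀ x ∈ Ici (0 : ℝ), HasDerivAt H (H' x) x := by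
      intro x _
      convert! ((hasDerivAt_kink x).mul
        ((hasDerivAt_sechSq x).mul (hv x).hasDerivAt)).const_mul 2 using 1
      simp only [hH', Pi.mul_apply]
      ring
    have hl : Tendsto H atTop (𝓝 0) := by
      have h := (tendsto_kink.mul (tendsto_sechSq.mul
        (tendsto_zero_of_integrableOn_sq hv h0 h1))).const_mul 2
      convert! h using 2
      norm_num
    rw [integral_Ioi_of_hasDerivAt_of_tendsto' hd iH' hl]
    simp [hH, kink_zero]
  have hexp : (fun x => deriv (fun x => v x - a * sechSq x) x ^ 2
        - 3 / 2 * (sechSq x * (v x - a * sechSq x) ^ 2)) =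
      fun x => (deriv v x ^ 2 - 3 / 2 * (sechSq x * v x ^ 2)) + a * H' x
        + 2 * a * (v x * sechSq x) + a ^ 2 * sechSq x ^ 2 - 5 / 2 * a ^ 2 * sechSq x ^ 3 := by
    funext x
    rw [hderiv]
    simp only [hH', sechSq]
    ring
  have j1 := iφ.fun_add (iH'.const_mul a)
  have j2 := j1.fun_add (ivp.const_mul (2 * a))
  have j3 := j2.fun_add (i2.const_mul (a ^ 2))
  rw [hexp, integral_sub j3 (i3.const_mul _), integral_add j2 (i2.const_mul _),
    integral_add j1 (ivp.const_mul _), integral_add iφ (iH'.const_mul a)] at key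
  simp only [integral_const_mul] at key
  rw [eH, e2, e3, ← hW, ha] at key
  linarith

/-- For `v` orthogonal to `eta`, the component of `v` along `sechSq` is small. -/
lemma inner_sechSq_sq_le {v : ℝ → ℝ} (hv : Continuous v)
    (h0 : IntegrableOn (fun x => v x ^ 2) (Ioi 0))
    (horth : ∫ x in Ioi 0, v x * eta x = 0) :
    (∫ x in Ioi 0, v x * sechSq x) ^ 2 ≤ 31 / 120 * ∫ x in Ioi 0, v x ^ 2 := by
  set W := ∫ x in Ioi 0, v x * sechSq x with hW
  obtain ⟨i1, e1⟩ := integral_sechSq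
  obtain ⟨i2, e2⟩ := integral_sechSq_sq
  obtain ⟨i3, e3⟩ := integral_sechSq_cube
  have ivp : IntegrableOn (fun x => v x * sechSq x) (Ioi 0) :=
    integrable_mul_of_integrable_sq hv.measurable continuous_sechSq.measurable h0 i2
  have ie : IntegrableOn (fun x => eta x ^ 2) (Ioi 0) := by
    have h : (fun x => eta x ^ 2) = fun x => 1 / 4 * sechSq x := by
      funext x; rw [sechSq_eq_eta]; ring
    rw [h]
    exact i1.const_mul (1 / 4)
  have ive : IntegrableOn (fun x => v x * eta x) (Ioi 0) :=
    integrable_mul_of_integrable_sq hv.measurable continuous_eta.measurable h0 ie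
  set l : ℝ := 120 / 31 * W with hl
  have hpt : ∀ x, 0 ≤ v x ^ 2 - 2 * l * (v x * sechSq x) + 3 * l * (v x * eta x)
      + l ^ 2 * (9 / 16) * sechSq x - l ^ 2 * (5 / 4) * sechSq x ^ 2
      + l ^ 2 * (3 / 4) * sechSq x ^ 3 := by
    intro x
    have hs := eta_pos x
    have hsq : (sechSq x - 3 / 2 * eta x) ^ 2 ≤
        9 / 16 * sechSq x - 5 / 4 * sechSq x ^ 2 + 3 / 4 * sechSq x ^ 3 := by
      rw [sechSq_eq_eta]
      have h : 0 ≤ eta x ^ 3 * ((1 - 2 * eta x) ^ 2 * (1 + eta x)) := by positivity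
      nlinarith [h]
    nlinarith [sq_nonneg (v x - l * (sechSq x - 3 / 2 * eta x)),
      mul_le_mul_of_nonneg_left hsq (sq_nonneg l)]
  have key : 0 ≤ ∫ x in Ioi 0, (v x ^ 2 - 2 * l * (v x * sechSq x) + 3 * l * (v x * eta x)
      + l ^ 2 * (9 / 16) * sechSq x - l ^ 2 * (5 / 4) * sechSq x ^ 2
      + l ^ 2 * (3 / 4) * sechSq x ^ 3) := integral_nonneg hpt
  have j1 := h0.fun_sub (ivp.const_mul (2 * l))
  have j2 := j1.fun_add (ive.const_mul (3 * l))
  have j3 := j2.fun_add (i1.const_mul (l ^ 2 * (9 / 16)))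
  have j4 := j3.fun_sub (i2.const_mul (l ^ 2 * (5 / 4)))
  rw [integral_add j4 (i3.const_mul _), integral_sub j3 (i2.const_mul _),
    integral_add j2 (i1.const_mul _), integral_add j1 (ive.const_mul _),
    integral_sub h0 (ivp.const_mul _)] at key
  simp only [integral_const_mul] at key
  rw [e1, e2, e3, horth, ← hW, hl] at key
  linarith

/-- Coercivity on the half-line. -/
lemma half_line_coercive {v : ℝ → ℝ} (hv : Differentiable ℝ v)
    (h0 : IntegrableOn (fun x => v x ^ 2) (Ioi 0))
    (h1 : IntegrableOn (fun x => deriv v x ^ 2) (Ioi 0))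
    (horth : ∫ x in Ioi 0, v x * eta x = 0) :
    1 / 100 * (∫ x in Ioi 0, (v x ^ 2 + deriv v x ^ 2)) ≤
      ∫ x in Ioi 0, (1 / 2 * deriv v x ^ 2 + 1 / 8 * v x ^ 2 - 3 * eta x ^ 2 * v x ^ 2) := by
  have hp : IntegrableOn (fun x => sechSq x * v x ^ 2) (Ioi 0) :=
    integrable_mul_of_abs_le_one continuous_sechSq abs_sechSq_le_one h0
  have hN : ∫ x in Ioi 0, sechSq x * v x ^ 2 ≤ ∫ x in Ioi 0, v x ^ 2 :=
    integral_mono hp h0 fun x => mul_le_of_le_one_left (sq_nonneg _) (sechSq_le_one x)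
  have hA := neg_inner_sechSq_sq_le hv h0 h1
  have hB := inner_sechSq_sq_le hv.continuous h0 horth
  have hE : (fun x => 1 / 2 * deriv v x ^ 2 + 1 / 8 * v x ^ 2 - 3 * eta x ^ 2 * v x ^ 2) =
      fun x => 1 / 2 * deriv v x ^ 2 + 1 / 8 * v x ^ 2 - 3 / 4 * (sechSq x * v x ^ 2) := by
    funext x; rw [sechSq_eq_eta]; ring
  have hD := integral_nonneg (μ := volume.restrict (Ioi (0 : ℝ))) (f := fun x => deriv v x ^ 2)
    fun x => sq_nonneg (deriv v x)
  rw [integral_sub h1 (hp.const_mul _), integral_const_mul] at hA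
  rw [hE, integral_sub (Integrable.fun_add (h1.const_mul _) (h0.const_mul _)) (hp.const_mul _),
    integral_add (h1.const_mul _) (h0.const_mul _), integral_add h0 h1]
  simp only [integral_const_mul]
  linarith

lemma integral_eq_two_mul_of_even {f : ℝ → ℝ} (hf : ∀ x, f (-x) = f x) :
    ∫ x, f x = 2 * ∫ x in Ioi 0, f x := by
  rw [← integral_comp_abs]
  congr 1
  funext x
  rcases abs_choice x with h | h <;> rw [h]
  exact (hf x).symm

lemma eta_neg (x : ℝ) : eta (-x) = eta x := by
  rw [eta, eta, neg_div, Real.cosh_neg]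

/-- two-sided coercivity of the linearized operator (estimate (2.12)): there exist
`0 < c ≤ C` such that for every even `H¹` function `v` orthogonal to `η`,
`c‖v‖_{H¹}² ≤ ∫ ((1/2)v'² + (1/8)v² − 3η²v²) ≤ C‖v‖_{H¹}²`. -/
theorem linearized_operator_coercive :
    ∃ c C : ℝ, 0 < c ∧ c ≤ C ∧
      ∀ v : ℝ → ℝ, (∀ x, v (-x) = v x) → Differentiable ℝ v →
        Integrable (fun x => (v x)^2) → Integrable (fun x => (deriv v x)^2) →
        (∫ x : ℝ, v x * eta x) = 0 →
        c * H1sq v ≤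
          (∫ x : ℝ, ((1/2) * (deriv v x)^2 + (1/8) * (v x)^2 - 3 * (eta x)^2 * (v x)^2)) ∧
        (∫ x : ℝ, ((1/2) * (deriv v x)^2 + (1/8) * (v x)^2 - 3 * (eta x)^2 * (v x)^2)) ≤
          C * H1sq v := by
  refine ⟨1 / 100, 1 / 2, by norm_num, by norm_num, ?_⟩
  intro v hev hv h0 h1 horth
  have hd : ∀ x, deriv v (-x) ^ 2 = deriv v x ^ 2 := by
    intro x
    have h := deriv_comp_neg v x
    rw [funext hev] at h
    rw [h, neg_sq]
  constructor
  · rw [integral_eq_two_mul_of_even fun x => by rw [hev, eta_neg]] at horth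
    rw [H1sq, integral_eq_two_mul_of_even fun x => by rw [hev, hd],
      integral_eq_two_mul_of_even fun x => by rw [hev, hd, eta_neg]]
    have h := half_line_coercive hv h0.integrableOn h1.integrableOn (by linarith)
    linarith
  · have hp : Integrable fun x => 3 * eta x ^ 2 * v x ^ 2 := by
      convert! (integrable_mul_of_abs_le_one continuous_sechSq abs_sechSq_le_one h0).const_mul
        (3 / 4) using 1
      funext x
      rw [sechSq_eq_eta]; ring
    rw [H1sq, ← integral_const_mul]
    refine integral_mono (((h1.const_mul _).add (h0.const_mul _)).sub hp)
      ((h0.add h1).const_mul _) fun x => ?_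
    have : 0 ≤ 3 * eta x ^ 2 * v x ^ 2 := by positivity
    dsimp only
    linarith [sq_nonneg (v x)]
end

section
/- Nonlinear Gronwall-type decay lemma: let c, C, B > 0 with C·B < c, and let f : [0,∞) → ℝ be differentiable with f(t) ≥ 0 for all t, f(0) ≤ B², and f'(t) ≤ −c·f(t) + C·f(t)^{3/2} for all t ≥ 0. Then f(t) ≤ B²·e^{−(c − C·B)·t} for all t ≥ 0. -/
theorem Real.rpow_three_halves_le_mul {x B : ℝ} (hx : 0 ≤ x) (hB : 0 ≤ B) (h : x ≤ B ^ 2) :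
    x ^ ((3 : ℝ) / 2) ≤ B * x := by
  have hsplit : x ^ ((3 : ℝ) / 2) = x * √x := by
    rw [Real.sqrt_eq_rpow, show (3 : ℝ) / 2 = 1 + 1 / 2 by norm_num,
      Real.rpow_add_of_nonneg hx zero_le_one (by norm_num), Real.rpow_one]
  rw [hsplit, mul_comm B x]
  exact mul_le_mul_of_nonneg_left (Real.sqrt_le_left hB |>.2 h) hx

/-- nonlinear Gronwall-type decay lemma: if `c, C, B > 0` with `CB < c` and
`f : [0,∞) → ℝ` is differentiable, nonnegative, with `f(0) ≤ B²` and
`f' ≤ −cf + Cf^{3/2}`, then `f(t) ≤ B² e^{−(c−CB)t}` for all `t ≥ 0`. -/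
theorem nonlinear_gronwall_decay (c C B : ℝ) (hc : 0 < c) (hC : 0 < C) (hB : 0 < B)
    (hCB : C * B < c) (f : ℝ → ℝ)
    (hdiff : ∀ t : ℝ, 0 ≤ t → DifferentiableAt ℝ f t)
    (hpos : ∀ t : ℝ, 0 ≤ t → 0 ≤ f t)
    (h0 : f 0 ≤ B^2)
    (hineq : ∀ t : ℝ, 0 ≤ t → deriv f t ≤ -c * f t + C * (f t) ^ ((3:ℝ)/2)) :
    ∀ t : ℝ, 0 ≤ t → f t ≤ B^2 * Real.exp (-(c - C * B) * t) := by
  intro t ht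
  have hcont : ContinuousOn f (Set.Icc 0 t) :=
    fun x hx => (hdiff x hx.1).continuousAt.continuousWithinAt
  have hderiv : ∀ x ∈ Set.Ico 0 t, HasDerivWithinAt f (deriv f x) (Set.Ici x) x :=
    fun x hx => (hdiff x hx.1).hasDerivAt.hasDerivWithinAt
  have hlin : ∀ x, 0 ≤ x → f x ≤ B ^ 2 → deriv f x ≤ -(c - C * B) * f x := by
    intro x hx hfx
    have := mul_le_mul_of_nonneg_left
      (Real.rpow_three_halves_le_mul (hpos x hx) hB.le hfx) hC.le
    linarith [hineq x hx]
  have hbdd : ∀ ⦃x⦄, x ∈ Set.Icc 0 t → f x ≤ B ^ 2 := by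
    refine image_le_of_deriv_right_lt_deriv_boundary hcont hderiv h0
      (fun x => hasDerivAt_const x (B ^ 2)) fun x hx hfx => ?_
    refine (hlin x hx.1 hfx.le).trans_lt ?_
    rw [hfx]
    exact mul_neg_of_neg_of_pos (by linarith) (by positivity)
  have hgronwall := le_gronwallBound_of_liminf_deriv_right_le (ε := 0) hcont
    (fun x hx _ hr => (hderiv x hx).liminf_right_slope_le hr) h0
    (fun x hx => by simpa using hlin x hx.1 (hbdd ⟨hx.1, hx.2.le⟩)) t ⟨ht, le_rfl⟩
  simpa [gronwallBound_ε0] using hgronwall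
end
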